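/- Fix p > 1, let q = p/(p−1), and define Φ_p(ρ,m) = |m|^q/(q ρ^{q−1}) if ρ > 0, Φ_p(0,0) = 0, and +∞ otherwise. Fix γ > 0 and (ρ,m) ∈ ℝ × ℝ^d. If ρ + |m|^p/(pγ^{p−1}) ≤ 0, then (0,0) is the unique minimizer of (σ,u) ↦ γΦ_p(σ,u) + (1/2)|(σ,u) − (ρ,m)|². If instead ρ + |m|^p/(pγ^{p−1}) > 0, then the unique minimizer is (θ, (θ/(θ + γ^{2/q} p^{1−2/q} (θ − ρ)^{1−2/q}))·m), where θ ≥ max{0,ρ} is the unique solution of (γ(t − ρ)^{1/p} + t(p/γ)^{1−2/p}(t − ρ)^{1/q})^p = γ|m|^p/p. -/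

import Mathlib

open Filter Topology
open scoped Classical

-- The power perspective cost `Φ_p(ρ,m) = |m|^q/(q ρ^{q-1})` (with `q` conjugate to `p`).
noncomputable def PhiPow {d : ℕ} (q : ℝ) (z : ℝ × EuclideanSpace ℝ (Fin d)) : EReal :=
  if 0 < z.1 then ((‖z.2‖ ^ q / (q * z.1 ^ (q - 1)) : ℝ) : EReal)
  else if z.1 = 0 ∧ z.2 = 0 then 0 else ⊤

-- `IsProxP f x z` : `z` is a minimizer of `y ↦ f y + (1/2)|y - x|²` (Euclidean norm on ℝ × ℝ^d).
def IsProxP {d : ℕ} (f : ℝ × EuclideanSpace ℝ (Fin d) → EReal)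
    (x z : ℝ × EuclideanSpace ℝ (Fin d)) : Prop :=
  ∀ y : ℝ × EuclideanSpace ℝ (Fin d),
    f z + (((1/2) * ((z.1 - x.1)^2 + ‖z.2 - x.2‖^2) : ℝ) : EReal) ≤
      f y + (((1/2) * ((y.1 - x.1)^2 + ‖y.2 - x.2‖^2) : ℝ) : EReal)

lemma young_aux {p q γ : ℝ} (hpq : p.HolderConjugate q) (hγ : 0 < γ)
    {α σ A B : ℝ} (hσ : 0 < σ) (hA : 0 ≤ A) (hB : 0 ≤ B)
    (hK : α + B ^ p / (p * γ ^ (p - 1)) ≤ 0) :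
    α * σ + B * A ≤ γ * (A ^ q / (q * σ ^ (q - 1))) := by
  have hp := hpq.pos
  have hq := hpq.symm.pos
  have h := Real.young_inequality_of_nonneg (div_nonneg hB hγ.le) (div_nonneg hA hσ.le) hpq
  rw [Real.div_rpow hB hγ.le, Real.div_rpow hA hσ.le] at h
  have e1 : γ ^ p = γ ^ (p - 1) * γ := by
    rw [← Real.rpow_add_one hγ.ne']; ring_nf
  have e2 : σ ^ q = σ ^ (q - 1) * σ := by
    rw [← Real.rpow_add_one hσ.ne']; ring_nf
  rw [e1, e2] at h
  have g1 : 0 < γ ^ (p - 1) := Real.rpow_pos_of_pos hγ _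
  have g2 : 0 < σ ^ (q - 1) := Real.rpow_pos_of_pos hσ _
  have h2 := mul_le_mul_of_nonneg_left h (mul_pos hγ hσ).le
  have h3 := mul_le_mul_of_nonneg_right hK hσ.le
  have l1 : γ * σ * (B / γ * (A / σ)) = B * A := by field_simp
  have l2 : γ * σ * (B ^ p / (γ ^ (p - 1) * γ) / p + A ^ q / (σ ^ (q - 1) * σ) / q)
      = B ^ p / (p * γ ^ (p - 1)) * σ + γ * (A ^ q / (q * σ ^ (q - 1))) := by
    field_simp
  rw [l1, l2] at h2
  linarith

lemma phi_lower {d : ℕ} {p q γ : ℝ} (hpq : p.HolderConjugate q) (hγ : 0 < γ)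
    {α : ℝ} {β : EuclideanSpace ℝ (Fin d)}
    (hK : α + ‖β‖ ^ p / (p * γ ^ (p - 1)) ≤ 0) (y : ℝ × EuclideanSpace ℝ (Fin d)) :
    (γ : EReal) * PhiPow q y = ⊤ ∨
    ∃ r : ℝ, (γ : EReal) * PhiPow q y = (r : EReal) ∧ α * y.1 + inner ℝ β y.2 ≤ r := by
  unfold PhiPow
  split_ifs with h1 h2
  · right
    refine ⟨_, (EReal.coe_mul _ _).symm, ?_⟩
    have := young_aux hpq hγ h1 (norm_nonneg y.2) (norm_nonneg β) hK
    have := real_inner_le_norm β y.2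
    linarith
  · right
    refine ⟨0, by simp, ?_⟩
    simp [h2.1, h2.2]
  · left
    exact EReal.coe_mul_top_of_pos hγ

lemma prox_key {d : ℕ} {p q γ : ℝ} (hpq : p.HolderConjugate q) (hγ : 0 < γ)
    (ρ : ℝ) (m : EuclideanSpace ℝ (Fin d)) (σ : ℝ) (u : EuclideanSpace ℝ (Fin d))
    (hK : (ρ - σ) + ‖m - u‖ ^ p / (p * γ ^ (p - 1)) ≤ 0)
    (hΦ : (γ : EReal) * PhiPow q (σ, u) = (((ρ - σ) * σ + inner ℝ (m - u) u : ℝ) : EReal)) :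
    IsProxP (fun z => (γ : EReal) * PhiPow q z) (ρ, m) (σ, u) ∧
        ∀ z, IsProxP (fun z => (γ : EReal) * PhiPow q z) (ρ, m) z → z = (σ, u) := by
  have expand : ∀ y : EuclideanSpace ℝ (Fin d), ‖y - m‖ ^ 2 =
      ‖u - m‖ ^ 2 + ‖y - u‖ ^ 2 - 2 * (inner ℝ (m - u) y - inner ℝ (m - u) u) := by
    intro y
    have : y - m = (y - u) - (m - u) := by abel
    rw [this, norm_sub_sq_real, norm_sub_rev u m, real_inner_comm, inner_sub_right]
    ring
  constructor
  · intro y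
    simp only [hΦ]
    rcases phi_lower hpq hγ hK y with h | ⟨r, h, hr⟩
    · rw [h, EReal.top_add_coe]; exact le_top
    · rw [h, ← EReal.coe_add, ← EReal.coe_add, EReal.coe_le_coe_iff, expand y.2]
      nlinarith [sq_nonneg (y.1 - σ), sq_nonneg ‖y.2 - u‖]
  · intro z hz
    have h0 := hz (σ, u)
    simp only [hΦ] at h0
    rcases phi_lower hpq hγ hK z with h | ⟨r, h, hr⟩
    · rw [h, EReal.top_add_coe, ← EReal.coe_add, top_le_iff] at h0
      exact absurd h0 (EReal.coe_ne_top _)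
    · rw [h, ← EReal.coe_add, ← EReal.coe_add, EReal.coe_le_coe_iff, expand z.2] at h0
      have h5 : (z.1 - σ) ^ 2 + ‖z.2 - u‖ ^ 2 ≤ 0 := by nlinarith
      have h6 : z.1 - σ = 0 := by nlinarith [sq_nonneg (z.1 - σ), sq_nonneg ‖z.2 - u‖]
      have h7 : ‖z.2 - u‖ = 0 := by nlinarith [sq_nonneg (z.1 - σ), sq_nonneg ‖z.2 - u‖]
      exact Prod.ext (sub_eq_zero.mp h6) (sub_eq_zero.mp (norm_eq_zero.mp h7))

lemma root_aux {a b γ K ρ R : ℝ} (ha : 0 < a) (hb : 0 < b) (hγ : 0 < γ) (hK : 0 < K)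
    (hR : γ * (max 0 ρ - ρ) ^ a + max 0 ρ * K * (max 0 ρ - ρ) ^ b ≤ R) (hR0 : 0 ≤ R) :
    ∃ θ, max 0 ρ ≤ θ ∧ γ * (θ - ρ) ^ a + θ * K * (θ - ρ) ^ b = R ∧
      ∀ t, max 0 ρ ≤ t → γ * (t - ρ) ^ a + t * K * (t - ρ) ^ b = R → t = θ := by
  set F : ℝ → ℝ := fun t => γ * (t - ρ) ^ a + t * K * (t - ρ) ^ b with hF
  have hc : Continuous F := by
    have h1 : Continuous fun t : ℝ => (t - ρ) ^ a :=
      (continuous_id.sub continuous_const).rpow_const (fun _ => Or.inr ha.le)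
    have h2 : Continuous fun t : ℝ => (t - ρ) ^ b :=
      (continuous_id.sub continuous_const).rpow_const (fun _ => Or.inr hb.le)
    fun_prop
  have hmono : ∀ s t, max 0 ρ ≤ s → s < t → F s < F t := by
    intro s t hs hst
    have hs0 : 0 ≤ s := (le_max_left _ _).trans hs
    have hsρ : 0 ≤ s - ρ := sub_nonneg.mpr ((le_max_right _ _).trans hs)
    have h1 : (s - ρ) ^ a < (t - ρ) ^ a := Real.rpow_lt_rpow hsρ (by linarith) ha
    have h2 : (s - ρ) ^ b ≤ (t - ρ) ^ b := Real.rpow_le_rpow hsρ (by linarith) hb.le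
    have h3 : 0 ≤ (s - ρ) ^ b := Real.rpow_nonneg hsρ _
    have h4 : s * K * (s - ρ) ^ b ≤ t * K * (t - ρ) ^ b := by
      apply mul_le_mul _ h2 h3 (by nlinarith)
      nlinarith
    have h5 := mul_lt_mul_of_pos_left h1 hγ
    simp only [hF]
    linarith
  set t1 := max 0 ρ + (R / γ) ^ (1 / a) with ht1
  have hw : 0 ≤ (R / γ) ^ (1 / a) := Real.rpow_nonneg (div_nonneg hR0 hγ.le) _
  have hle : max 0 ρ ≤ t1 := by linarith
  have hup : R ≤ F t1 := by
    have h1 : (R / γ) ^ (1 / a) ≤ t1 - ρ := by linarith [le_max_right 0 ρ]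
    have h2 := Real.rpow_le_rpow hw h1 ha.le
    rw [← Real.rpow_mul (div_nonneg hR0 hγ.le), one_div_mul_cancel ha.ne', Real.rpow_one] at h2
    have h3 : 0 ≤ t1 * K * (t1 - ρ) ^ b := by
      have : 0 ≤ t1 := (le_max_left _ _).trans hle
      have : 0 ≤ (t1 - ρ) ^ b := Real.rpow_nonneg (hw.trans h1) _
      positivity
    have h4 := mul_le_mul_of_nonneg_left h2 hγ.le
    rw [mul_div_cancel₀ _ hγ.ne'] at h4
    simp only [hF]
    linarith
  obtain ⟨θ, hθ, hθR⟩ := intermediate_value_Icc hle hc.continuousOn ⟨hR, hup⟩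
  refine ⟨θ, hθ.1, hθR, fun t ht htR => ?_⟩
  rcases lt_trichotomy t θ with h | h | h
  · have := hmono _ _ ht h
    have h' : F t = R := htR
    linarith
  · exact h
  · have := hmono _ _ hθ.1 h
    have h' : F t = R := htR
    linarith

lemma eq_iff_aux {p γ F M : ℝ} (hp : 1 < p) (hγ : 0 < γ) (hF : 0 ≤ F) (hM : 0 ≤ M) :
    F ^ p = γ * M ^ p / p ↔ F = (γ / p) ^ (1 / p) * M := by
  have hp0 : 0 < p := by linarith
  have hgp : 0 ≤ γ / p := by positivity
  have : γ * M ^ p / p = ((γ / p) ^ (1 / p) * M) ^ p := by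
    rw [Real.mul_rpow (Real.rpow_nonneg hgp _) hM, ← Real.rpow_mul hgp,
      one_div_mul_cancel hp0.ne', Real.rpow_one]
    ring
  rw [this]
  exact Real.rpow_left_inj hF (mul_nonneg (Real.rpow_nonneg hgp _) hM) hp0.ne'

lemma coeff_aux {p q γ s : ℝ} (hp0 : 0 < p) (hinv : p⁻¹ + q⁻¹ = 1) (hγ : 0 < γ) (hs : 0 < s) :
    γ ^ ((2 : ℝ) / q) * p ^ ((1 : ℝ) - 2 / q) * s ^ ((1 : ℝ) - 2 / q) =
      γ * (p / γ * s) ^ (1 / p) / (p / γ * s) ^ (1 / q) := by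
  have hbs : 0 < p / γ * s := by positivity
  have e1 : (1 : ℝ) / p - 1 / q = 1 - 2 / q := by
    rw [one_div, one_div, div_eq_mul_inv]; linarith
  have e2 : (2 : ℝ) / q = 1 - (1 - 2 / q) := by ring
  rw [mul_div_assoc, ← Real.rpow_sub hbs, e1, Real.mul_rpow (by positivity) hs.le,
    Real.div_rpow hp0.le hγ.le]
  have : γ ^ ((2 : ℝ) / q) = γ / γ ^ (1 - 2 / q) := by
    conv_lhs => rw [e2]
    rw [Real.rpow_sub hγ, Real.rpow_one]
  rw [this]
  ring

lemma norm_aux {p q γ s θ M : ℝ} (hp0 : 0 < p) (hinv : p⁻¹ + q⁻¹ = 1) (hγ : 0 < γ) (hs : 0 < s)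
    (h : γ * s ^ (1 / p) + θ * (p / γ) ^ ((1 : ℝ) - 2 / p) * s ^ (1 / q) = (γ / p) ^ (1 / p) * M) :
    M = θ * (p / γ * s) ^ (1 / q) + γ * (p / γ * s) ^ (1 / p) := by
  have hb : 0 < p / γ := by positivity
  have e : (1 : ℝ) / q = 1 / p + (1 - 2 / p) := by
    rw [one_div, one_div, div_eq_mul_inv]; linarith
  have e2 : (p / γ) ^ (1 / p) * (γ / p) ^ (1 / p) = 1 := by
    rw [← Real.mul_rpow hb.le (by positivity)]
    have : p / γ * (γ / p) = 1 := by field_simp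
    rw [this, Real.one_rpow]
  have e3 : (p / γ) ^ (1 / q) = (p / γ) ^ (1 / p) * (p / γ) ^ ((1 : ℝ) - 2 / p) := by
    rw [e, Real.rpow_add hb]
  rw [Real.mul_rpow hb.le hs.le, Real.mul_rpow hb.le hs.le, e3]
  linear_combination (-(p / γ) ^ (1 / p)) * h - M * e2

/-- formula for `Prox_{γΦ_p}(ρ,m)`. If `ρ + |m|^p/(pγ^{p−1}) ≤ 0` the prox is
`(0,0)`; otherwise it is `(θ, (θ/(θ + γ^{2/q} p^{1−2/q} (θ − ρ)^{1−2/q}))·m)` where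
`θ ≥ max{0,ρ}` is the unique root of
`(γ(t − ρ)^{1/p} + t(p/γ)^{1−2/p}(t − ρ)^{1/q})^p = γ|m|^p/p`. -/
theorem prox_power
    (d : ℕ) (hd : 1 ≤ d)
    (p q γ : ℝ) (hp : 1 < p) (hq : q = p / (p - 1)) (hγ : 0 < γ)
    (ρ : ℝ) (m : EuclideanSpace ℝ (Fin d)) :
    ((ρ + ‖m‖ ^ p / (p * γ ^ (p - 1)) ≤ 0) →
      (IsProxP (fun z => (γ : EReal) * PhiPow q z) (ρ, m) (0, 0) ∧
        ∀ z, IsProxP (fun z => (γ : EReal) * PhiPow q z) (ρ, m) z → z = (0, 0))) ∧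
    ((0 < ρ + ‖m‖ ^ p / (p * γ ^ (p - 1))) →
      ∃ θ : ℝ, max 0 ρ ≤ θ ∧
        (γ * (θ - ρ) ^ ((1 : ℝ) / p) +
          θ * (p / γ) ^ ((1 : ℝ) - 2 / p) * (θ - ρ) ^ ((1 : ℝ) / q)) ^ p = γ * ‖m‖ ^ p / p ∧
        (∀ t : ℝ, max 0 ρ ≤ t →
          (γ * (t - ρ) ^ ((1 : ℝ) / p) +
            t * (p / γ) ^ ((1 : ℝ) - 2 / p) * (t - ρ) ^ ((1 : ℝ) / q)) ^ p = γ * ‖m‖ ^ p / p →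
          t = θ) ∧
        IsProxP (fun z => (γ : EReal) * PhiPow q z) (ρ, m)
          (θ, (θ / (θ + γ ^ ((2 : ℝ) / q) * p ^ ((1 : ℝ) - 2 / q) *
            (θ - ρ) ^ ((1 : ℝ) - 2 / q))) • m) ∧
        ∀ z, IsProxP (fun z => (γ : EReal) * PhiPow q z) (ρ, m) z →
          z = (θ, (θ / (θ + γ ^ ((2 : ℝ) / q) * p ^ ((1 : ℝ) - 2 / q) *
            (θ - ρ) ^ ((1 : ℝ) - 2 / q))) • m)) := by
  have hpq : p.HolderConjugate q := by
    rw [Real.holderConjugate_iff_eq_conjExponent hp]; exact hq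
  have hp0 := hpq.pos
  have hq0 := hpq.symm.pos
  have hinv : p⁻¹ + q⁻¹ = 1 := hpq.inv_add_inv_eq_one
  have hgp1 : 0 < γ ^ (p - 1) := Real.rpow_pos_of_pos hγ _
  have hgpow : γ ^ p = γ ^ (p - 1) * γ := by
    rw [← Real.rpow_add_one hγ.ne']; ring_nf
  constructor
  · intro h
    apply prox_key hpq hγ
    · simpa using h
    · simp [PhiPow]
  · intro h
    have hb : 0 < p / γ := by positivity
    have hKpos : 0 < (p / γ) ^ ((1 : ℝ) - 2 / p) := Real.rpow_pos_of_pos hb _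
    have hM := norm_nonneg m
    have hnn : ∀ t, max 0 ρ ≤ t → 0 ≤ γ * (t - ρ) ^ ((1 : ℝ) / p) +
          t * (p / γ) ^ ((1 : ℝ) - 2 / p) * (t - ρ) ^ ((1 : ℝ) / q) := by
      intro t ht
      have h1 : 0 ≤ t := (le_max_left _ _).trans ht
      have h2 : 0 ≤ t - ρ := sub_nonneg.mpr ((le_max_right _ _).trans ht)
      have := Real.rpow_nonneg h2 ((1 : ℝ) / p)
      have := Real.rpow_nonneg h2 ((1 : ℝ) / q)
      positivity
    have hR0 : 0 ≤ (γ / p) ^ (1 / p) * ‖m‖ := by positivity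
    obtain ⟨θ, hθ, hθR, hθu⟩ := root_aux (a := 1 / p) (b := 1 / q) (γ := γ)
      (K := (p / γ) ^ ((1 : ℝ) - 2 / p)) (ρ := ρ) (R := (γ / p) ^ (1 / p) * ‖m‖)
      (by positivity) (by positivity) hγ hKpos (by
        rcases le_total 0 ρ with h0 | h0
        · rw [max_eq_right h0, sub_self, Real.zero_rpow (by positivity),
            Real.zero_rpow (by positivity)]
          simpa using hR0
        · rw [max_eq_left h0]
          have hρ : 0 ≤ 0 - ρ := by linarith
          have e : 0 ≤ γ * (0 - ρ) ^ (1 / p) :=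
            mul_nonneg hγ.le (Real.rpow_nonneg hρ _)
          rw [zero_mul, zero_mul, add_zero]
          rw [← Real.rpow_le_rpow_iff e hR0 hp0, ← (eq_iff_aux hp hγ hR0 hM).mpr rfl |>.symm,
            Real.mul_rpow hγ.le (Real.rpow_nonneg hρ _), ← Real.rpow_mul hρ,
            one_div_mul_cancel hp0.ne', Real.rpow_one, hgpow]
          have h1 : 0 - ρ ≤ ‖m‖ ^ p / (p * γ ^ (p - 1)) := by linarith
          calc γ ^ (p - 1) * γ * (0 - ρ)
              ≤ γ ^ (p - 1) * γ * (‖m‖ ^ p / (p * γ ^ (p - 1))) := by gcongr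
            _ = γ * ‖m‖ ^ p / p := by field_simp) hR0
    have hθ0 : 0 ≤ θ := (le_max_left _ _).trans hθ
    have hs0 : 0 ≤ θ - ρ := sub_nonneg.mpr ((le_max_right _ _).trans hθ)
    refine ⟨θ, hθ, (eq_iff_aux hp hγ (hnn θ hθ) hM).mpr hθR,
      fun t ht hte => hθu t ht ((eq_iff_aux hp hγ (hnn t ht) hM).mp hte), ?_⟩
    have hgpne : (γ / p) ^ (1 / p) ≠ 0 := (Real.rpow_pos_of_pos (by positivity) _).ne'
    have hθpos : 0 < θ := by
      rcases hθ0.eq_or_lt with h0 | h0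
      · exfalso
        subst h0
        have hE := (eq_iff_aux hp hγ (hnn 0 hθ) hM).mpr hθR
        rw [zero_mul, zero_mul, add_zero, Real.mul_rpow hγ.le (Real.rpow_nonneg hs0 _),
          ← Real.rpow_mul hs0, one_div_mul_cancel hp0.ne', Real.rpow_one, hgpow] at hE
        have : ‖m‖ ^ p / (p * γ ^ (p - 1)) = -ρ := by
          rw [div_eq_iff (by positivity)]
          rw [eq_div_iff hp0.ne'] at hE
          have : γ * (‖m‖ ^ p - -ρ * (p * γ ^ (p - 1))) = 0 := by linear_combination -hE
          rcases mul_eq_zero.mp this with h' | h'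
          · exact absurd h' hγ.ne'
          · linarith
        linarith
      · exact h0
    rcases hs0.eq_or_lt with hs | hs
    · have hm : m = 0 := by
        rw [← hs, Real.zero_rpow (by positivity), Real.zero_rpow (by positivity), mul_zero,
          mul_zero, add_zero] at hθR
        rcases mul_eq_zero.mp hθR.symm with h' | h'
        · exact absurd h' hgpne
        · exact norm_eq_zero.mp h'
      subst hm
      have hρ : ρ - θ = 0 := by linarith
      apply prox_key hpq hγ
      · simp [hρ, Real.zero_rpow hp0.ne']
      · simp [PhiPow, hθpos, hρ, Real.zero_rpow hq0.ne']
    · rw [coeff_aux hp0 hinv hγ hs]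
      have hMe := norm_aux hp0 hinv hγ hs hθR
      have hbs : 0 < p / γ * (θ - ρ) := by positivity
      have hX : 0 < (p / γ * (θ - ρ)) ^ (1 / p) := Real.rpow_pos_of_pos hbs _
      have ha : 0 < (p / γ * (θ - ρ)) ^ (1 / q) := Real.rpow_pos_of_pos hbs _
      have hXp : ((p / γ * (θ - ρ)) ^ (1 / p)) ^ p = p / γ * (θ - ρ) := by
        rw [← Real.rpow_mul hbs.le, one_div_mul_cancel hp0.ne', Real.rpow_one]
      have haq : ((p / γ * (θ - ρ)) ^ (1 / q)) ^ q = p / γ * (θ - ρ) := by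
        rw [← Real.rpow_mul hbs.le, one_div_mul_cancel hq0.ne', Real.rpow_one]
      have hXa : (p / γ * (θ - ρ)) ^ (1 / p) * (p / γ * (θ - ρ)) ^ (1 / q)
          = p / γ * (θ - ρ) := by
        rw [← Real.rpow_add hbs, one_div, one_div, hinv, Real.rpow_one]
      generalize (p / γ * (θ - ρ)) ^ (1 / p) = X at *
      generalize (p / γ * (θ - ρ)) ^ (1 / q) = a at *
      have hMpos : 0 < ‖m‖ := by rw [hMe]; positivity
      have hc : θ / (θ + γ * X / a) = θ * a / ‖m‖ := by
        rw [hMe]; field_simp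
      rw [hc]
      set c := θ * a / ‖m‖ with hcd
      have hc0 : 0 ≤ c := by positivity
      have hcM : c * ‖m‖ = θ * a := by rw [hcd]; field_simp
      have hc1 : (1 - c) * ‖m‖ = γ * X := by rw [sub_mul, hcM, hMe]; ring
      have hc1' : 0 ≤ 1 - c := by
        by_contra hneg
        have : 0 < γ * X := by positivity
        nlinarith
      have hmu : m - c • m = (1 - c) • m := by rw [sub_smul, one_smul]
      have hn1 : ‖m - c • m‖ = γ * X := by
        rw [hmu, norm_smul, Real.norm_of_nonneg hc1', hc1]
      have hn2 : ‖c • m‖ = θ * a := by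
        rw [norm_smul, Real.norm_of_nonneg hc0, hcM]
      have hin : inner ℝ (m - c • m) (c • m) = γ * X * (θ * a) := by
        rw [hmu, real_inner_smul_left, real_inner_smul_right, real_inner_self_eq_norm_sq,
          ← hc1, ← hcM]
        ring
      apply prox_key hpq hγ
      · rw [hn1, Real.mul_rpow hγ.le hX.le, hXp, hgpow]
        apply le_of_eq
        field_simp
        ring
      · have htq : θ ^ q = θ ^ (q - 1) * θ := by
          rw [← Real.rpow_add_one hθpos.ne']; ring_nf
        have htq1 : 0 < θ ^ (q - 1) := Real.rpow_pos_of_pos hθpos _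
        simp only [PhiPow, if_pos hθpos]
        rw [← EReal.coe_mul, EReal.coe_eq_coe_iff, hn2, hin, Real.mul_rpow hθpos.le ha.le, haq, htq]
        have h1 : γ * X * (θ * a) = p * (θ - ρ) * θ := by
          have : γ * X * (θ * a) = γ * θ * (X * a) := by ring
          rw [this, hXa]; field_simp
        rw [h1]
        have hq1 : p = q * (p - 1) := by
          rw [hq]; field_simp [(sub_pos.mpr hp).ne']
        have h2 : γ * (θ ^ (q - 1) * θ * (p / γ * (θ - ρ)) / (q * θ ^ (q - 1)))
            = p / q * θ * (θ - ρ) := by field_simp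
        rw [h2]
        have h3 : p / q = p - 1 := by rw [div_eq_iff hq0.ne']; linarith
        rw [h3]; ring
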